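/- Let H ∈ (0,1/2), T > 0 and t ∈ (0,T]. Then there exists β ∈ (0,1/2) such that ∫_0^t ∫_0^t (K_H(t,t_0′) − K_H(t,t_0))² / |t_0 − t_0′|^{1+2β} dt_0 dt_0′ < ∞. -/

import Mathlib

open MeasureTheory Real Filter Set
open scoped ENNReal NNReal BigOperators Classical

noncomputable section

/-- Euler Beta function `B(a,b) = Γ(a)Γ(b)/Γ(a+b)`. -/
def eulerBeta (a b : ℝ) : ℝ := Real.Gamma a * Real.Gamma b / Real.Gamma (a + b)

/-- Normalizing constant `c_H` of the fractional Brownian kernel. -/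
def cH (H : ℝ) : ℝ := Real.sqrt (2 * H / ((1 - 2 * H) * eulerBeta (1 - 2 * H) (H + 1 / 2)))

/-- The fractional Brownian kernel `K_H(t,s)`. -/
def KH (H t s : ℝ) : ℝ :=
  cH H * ((t / s) ^ (H - 1 / 2) * (t - s) ^ (H - 1 / 2)
    + (1 / 2 - H) * s ^ (1 / 2 - H) * ∫ u in Set.Ioo s t, u ^ (H - 3 / 2) * (u - s) ^ (H - 1 / 2))

/-- Hölder estimate of exponent `γ ≤ p` for the power function `x ↦ x ^ p` on bounded sets. -/
lemma rpow_sub_rpow_le_mul_rpow {x y p γ L : ℝ} (hx : 0 ≤ x) (hxy : x < y) (hL : y - x ≤ L)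
    (hγ : 0 ≤ γ) (hγp : γ ≤ p) (hp : p ≤ 1) :
    y ^ p - x ^ p ≤ L ^ (p - γ) * (y - x) ^ γ := by
  have hd : 0 < y - x := sub_pos.2 hxy
  have h1 := Real.rpow_add_le_add_rpow hx hd.le (hγ.trans hγp) hp
  rw [add_sub_cancel] at h1
  calc y ^ p - x ^ p ≤ (y - x) ^ ((p - γ) + γ) := by rw [sub_add_cancel]; linarith
    _ = (y - x) ^ (p - γ) * (y - x) ^ γ := Real.rpow_add hd _ _
    _ ≤ L ^ (p - γ) * (y - x) ^ γ := by
      gcongr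

/-- Weighted Hölder estimate for negative powers. -/
lemma rpow_neg_sub_rpow_neg_le {p q a γ : ℝ} (hp : 0 < p) (hpq : p ≤ q) (ha : a ≤ 1)
    (hγ₀ : 0 ≤ γ) (hγ₁ : γ ≤ 1) :
    p ^ (-a) - q ^ (-a) ≤ p ^ (-(a + γ)) * (q - p) ^ γ := by
  have hq : 0 < q := hp.trans_le hpq
  have hd : 0 ≤ q - p := sub_nonneg.2 hpq
  have h1 : q ^ (-a) = p ^ (-a) * (p / q) ^ a := by
    rw [Real.div_rpow hp.le hq.le, Real.rpow_neg hp.le, Real.rpow_neg hq.le]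
    have := (Real.rpow_pos_of_pos hp a).ne'
    field_simp
  have h2 : p / q ≤ (p / q) ^ a :=
    Real.self_le_rpow_of_le_one (by positivity) ((div_le_one hq).2 hpq) ha
  have h3 : (q - p) / q ≤ ((q - p) / q) ^ γ :=
    Real.self_le_rpow_of_le_one (by positivity) ((div_le_one hq).2 (by linarith)) hγ₁
  have h4 : ((q - p) / q) ^ γ ≤ ((q - p) / p) ^ γ := by gcongr
  have h5 : (q - p) / q = 1 - p / q := by field_simp
  calc p ^ (-a) - q ^ (-a) = p ^ (-a) * (1 - (p / q) ^ a) := by rw [h1]; ring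
    _ ≤ p ^ (-a) * ((q - p) / p) ^ γ := by
      gcongr
      linarith
    _ = p ^ (-(a + γ)) * (q - p) ^ γ := by
      rw [Real.div_rpow hd hp.le, neg_add, Real.rpow_add hp, Real.rpow_neg hp.le γ]
      ring

/-- The substitution `u = s t / r` in the integral term of the fractional Brownian kernel. -/
lemma setIntegral_Ioo_rpow_mul_sub_rpow {a s t : ℝ} (hs : 0 < s) (hst : s < t) :
    ∫ u in Ioo s t, u ^ (-a - 1) * (u - s) ^ (-a) =
      s ^ (-2 * a) * t ^ (-a) * ∫ r in s..t, r ^ (2 * a - 1) * (t - r) ^ (-a) := by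
  have ht : 0 < t := hs.trans hst
  have himg : (fun r => s * t / r) '' Ioo s t = Ioo s t := by
    ext u
    constructor
    · rintro ⟨r, ⟨h1, h2⟩, rfl⟩
      have hr : 0 < r := hs.trans h1
      constructor
      · rw [lt_div_iff₀ hr]; gcongr
      · rw [div_lt_iff₀ hr, mul_comm]; gcongr
    · rintro ⟨h1, h2⟩
      have hu : 0 < u := hs.trans h1
      refine ⟨s * t / u, ⟨?_, ?_⟩, ?_⟩
      · rw [lt_div_iff₀ hu]; gcongr
      · rw [div_lt_iff₀ hu, mul_comm]; gcongr
      · field_simp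
  have hinj : InjOn (fun r => s * t / r) (Ioo s t) := by
    intro r hr q hq h
    have h1 : r ≠ 0 := (hs.trans hr.1).ne'
    have h2 : q ≠ 0 := (hs.trans hq.1).ne'
    simp only at h
    field_simp at h
    exact h.symm
  have hder : ∀ r ∈ Ioo s t,
      HasDerivWithinAt (fun r => s * t / r) (-(s * t) / r ^ 2) (Ioo s t) r := by
    intro r hr
    have h1 : r ≠ 0 := (hs.trans hr.1).ne'
    have := ((hasDerivAt_inv h1).const_mul (s * t)).hasDerivWithinAt (s := Ioo s t)
    simpa only [div_eq_mul_inv, mul_neg, neg_mul] using this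
  have h := integral_image_eq_integral_abs_deriv_smul measurableSet_Ioo hder hinj
    (fun u => u ^ (-a - 1) * (u - s) ^ (-a))
  rw [himg] at h
  rw [h, intervalIntegral.integral_of_le hst.le, integral_Ioc_eq_integral_Ioo,
    ← integral_const_mul]
  refine setIntegral_congr_fun measurableSet_Ioo fun r hr => ?_
  have hr0 : 0 < r := hs.trans hr.1
  have htr : 0 < t - r := sub_pos.2 hr.2
  have e1 : s * t / r - s = s * (t - r) / r := by field_simp
  have e2 : |-(s * t) / r ^ 2| = s * t / r ^ 2 := by
    rw [neg_div, abs_neg, abs_of_pos (by positivity)]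
  simp only [smul_eq_mul]
  rw [e1, e2, Real.div_rpow (by positivity) hr0.le, Real.div_rpow (by positivity) hr0.le,
    Real.mul_rpow hs.le ht.le, Real.mul_rpow hs.le htr.le,
    show -2 * a = -a + -a by ring, show 2 * a - 1 = a + a - 1 by ring,
    Real.rpow_add hs, Real.rpow_sub_one hs.ne', Real.rpow_sub_one ht.ne',
    Real.rpow_sub_one hr0.ne', Real.rpow_sub_one hr0.ne', Real.rpow_add hr0,
    Real.rpow_neg hr0.le]
  have := (Real.rpow_pos_of_pos hr0 a).ne'
  field_simp

lemma intervalIntegrable_sub_rpow {p t x y : ℝ} (hp : -1 < p) :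
    IntervalIntegrable (fun r => (t - r) ^ p) volume x y := by
  simpa using
    (intervalIntegral.intervalIntegrable_rpow' hp (a := t - x) (b := t - y)).comp_sub_left t

lemma rpow_mul_sub_rpow_le {a t r : ℝ} (ha₀ : 0 < a) (ha₁ : a < 1 / 2) (hr : 0 < r) (hrt : r ≤ t) :
    r ^ (2 * a - 1) * (t - r) ^ (-a) ≤
      ((t / 2) ^ (-a) + (t / 2) ^ (2 * a - 1)) * (r ^ (2 * a - 1) + (t - r) ^ (-a)) := by
  have ht : 0 < t := hr.trans_le hrt
  have hP : 0 ≤ r ^ (2 * a - 1) := by positivity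
  have hQ : 0 ≤ (t - r) ^ (-a) := Real.rpow_nonneg (sub_nonneg.2 hrt) _
  have hA : 0 ≤ (t / 2) ^ (-a) := by positivity
  have hB : 0 ≤ (t / 2) ^ (2 * a - 1) := by positivity
  rcases le_total r (t / 2) with h | h
  · have : (t - r) ^ (-a) ≤ (t / 2) ^ (-a) :=
      Real.rpow_le_rpow_of_nonpos (by linarith) (by linarith) (by linarith)
    nlinarith [mul_le_mul_of_nonneg_left this hP, mul_nonneg hA hQ, mul_nonneg hB hQ,
      mul_nonneg hB hP]
  · have : r ^ (2 * a - 1) ≤ (t / 2) ^ (2 * a - 1) :=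
      Real.rpow_le_rpow_of_nonpos (by linarith) h (by linarith)
    nlinarith [mul_le_mul_of_nonneg_right this hQ, mul_nonneg hA hQ, mul_nonneg hA hP,
      mul_nonneg hB hP]

lemma intervalIntegrable_rpow_mul_sub_rpow {a t x y : ℝ} (ha₀ : 0 < a) (ha₁ : a < 1 / 2)
    (hx : 0 ≤ x) (hxy : x ≤ y) (hy : y ≤ t) :
    IntervalIntegrable (fun r => r ^ (2 * a - 1) * (t - r) ^ (-a)) volume x y := by
  have hD : IntervalIntegrable (fun r => ((t / 2) ^ (-a) + (t / 2) ^ (2 * a - 1)) *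
      (r ^ (2 * a - 1) + (t - r) ^ (-a))) volume x y :=
    ((intervalIntegral.intervalIntegrable_rpow' (by linarith)).add
      (intervalIntegrable_sub_rpow (by linarith))).const_mul _
  refine hD.mono_fun' (by fun_prop) ?_
  rw [uIoc_of_le hxy]
  refine (ae_restrict_iff' measurableSet_Ioc).2 (Eventually.of_forall fun r hr => ?_)
  have hr0 : 0 < r := hx.trans_lt hr.1
  have hrt : r ≤ t := hr.2.trans hy
  have hQ : 0 ≤ (t - r) ^ (-a) := Real.rpow_nonneg (sub_nonneg.2 hrt) _
  change ‖_‖ ≤ _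
  rw [Real.norm_of_nonneg (by positivity)]
  exact rpow_mul_sub_rpow_le ha₀ ha₁ hr0 hrt

lemma integral_rpow_mul_sub_rpow_nonneg {a t x y : ℝ} (hx : 0 ≤ x) (hxy : x ≤ y) (hy : y ≤ t) :
    0 ≤ ∫ r in x..y, r ^ (2 * a - 1) * (t - r) ^ (-a) :=
  intervalIntegral.integral_nonneg hxy fun _ hr =>
    mul_nonneg (Real.rpow_nonneg (hx.trans hr.1) _)
      (Real.rpow_nonneg (sub_nonneg.2 (hr.2.trans hy)) _)

lemma exists_integral_rpow_mul_sub_rpow_le {a t γ : ℝ} (ha₀ : 0 < a) (ha₁ : a < 1 / 2)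
    (ht : 0 < t) (hγ₀ : 0 ≤ γ) (hγ : γ ≤ a) :
    ∃ C, 0 ≤ C ∧ ∀ x y, 0 ≤ x → x < y → y ≤ t →
      ∫ r in x..y, r ^ (2 * a - 1) * (t - r) ^ (-a) ≤ C * (y - x) ^ γ := by
  refine ⟨((t / 2) ^ (-a) + (t / 2) ^ (2 * a - 1)) *
    (t ^ (2 * a - γ) / (2 * a) + t ^ (1 - a - γ) / (1 - a)), ?_, fun x y hx hxy hy => ?_⟩
  · have : 0 < 1 - a := by linarith
    positivity
  have hi₁ : IntervalIntegrable (fun r : ℝ => r ^ (2 * a - 1)) volume x y :=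
    intervalIntegral.intervalIntegrable_rpow' (by linarith)
  have hi₂ : IntervalIntegrable (fun r : ℝ => (t - r) ^ (-a)) volume x y :=
    intervalIntegrable_sub_rpow (by linarith)
  have hmono : ∫ r in x..y, r ^ (2 * a - 1) * (t - r) ^ (-a) ≤
      ∫ r in x..y, ((t / 2) ^ (-a) + (t / 2) ^ (2 * a - 1)) *
        (r ^ (2 * a - 1) + (t - r) ^ (-a)) :=
    intervalIntegral.integral_mono_on_of_le_Ioo hxy.le
      (intervalIntegrable_rpow_mul_sub_rpow ha₀ ha₁ hx hxy.le hy) ((hi₁.add hi₂).const_mul _)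
      fun r hr => rpow_mul_sub_rpow_le ha₀ ha₁ (hx.trans_lt hr.1) (hr.2.le.trans hy)
  refine hmono.trans ?_
  rw [intervalIntegral.integral_const_mul, intervalIntegral.integral_add hi₁ hi₂,
    intervalIntegral.integral_comp_sub_left (fun r => r ^ (-a)) t,
    integral_rpow (Or.inl (by linarith)), integral_rpow (Or.inl (by linarith)), mul_assoc]
  have h1 := rpow_sub_rpow_le_mul_rpow (L := t) (p := 2 * a) hx hxy (by linarith) hγ₀
    (by linarith) (by linarith)
  have h2 := rpow_sub_rpow_le_mul_rpow (x := t - y) (y := t - x) (L := t) (p := 1 - a)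
    (by linarith) (by linarith) (by linarith) hγ₀ (by linarith) (by linarith)
  rw [show t - x - (t - y) = y - x by ring] at h2
  rw [sub_add_cancel, show -a + 1 = 1 - a by ring,
    add_mul (t ^ (2 * a - γ) / (2 * a)), div_mul_eq_mul_div, div_mul_eq_mul_div]
  gcongr
  linarith

/-- Regularity of the first term of the kernel, with a weight singular at `t`. -/
lemma abs_rpow_mul_sub_rpow_sub_le {a t γ x y : ℝ} (ha₀ : 0 < a) (ha₁ : a < 1 / 2)
    (hγ₀ : 0 ≤ γ) (hγ : γ ≤ a) (hx : 0 < x) (hxy : x < y) (hy : y < t) :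
    |x ^ a * (t - x) ^ (-a) - y ^ a * (t - y) ^ (-a)| ≤
      2 * t ^ a * ((t - y) ^ (-(a + γ)) * (y - x) ^ γ) := by
  have ht : 0 < t := by linarith
  have hty : 0 < t - y := by linarith
  have htx : 0 < t - x := by linarith
  have hd : 0 < y - x := by linarith
  have h1 := rpow_sub_rpow_le_mul_rpow (L := t) hx.le hxy (by linarith) hγ₀ hγ (by linarith)
  have h2 := rpow_neg_sub_rpow_neg_le (p := t - y) (q := t - x) hty (by linarith)
    (a := a) (γ := γ) (by linarith) hγ₀ (by linarith)
  rw [show t - x - (t - y) = y - x by ring] at h2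
  have h3 : x ^ a ≤ y ^ a := by gcongr
  have h4 : (t - x) ^ (-a) ≤ (t - y) ^ (-a) :=
    Real.rpow_le_rpow_of_nonpos hty (by linarith) (by linarith)
  have h5 : (t - y) ^ (-a) ≤ t ^ γ * (t - y) ^ (-(a + γ)) := by
    rw [show -a = γ + -(a + γ) by ring, Real.rpow_add hty]
    gcongr
    linarith
  have hy0 : 0 < y := hx.trans hxy
  have h6 : y ^ a ≤ t ^ a := by gcongr
  have h7 : t ^ a = t ^ (a - γ) * t ^ γ := by rw [← Real.rpow_add ht, sub_add_cancel]
  have hA : (y ^ a - x ^ a) * (t - x) ^ (-a) ≤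
      t ^ a * ((t - y) ^ (-(a + γ)) * (y - x) ^ γ) := by
    calc (y ^ a - x ^ a) * (t - x) ^ (-a)
        ≤ (t ^ (a - γ) * (y - x) ^ γ) * (t ^ γ * (t - y) ^ (-(a + γ))) := by
          gcongr
          exact h4.trans h5
      _ = _ := by rw [h7]; ring
  have hB : y ^ a * ((t - y) ^ (-a) - (t - x) ^ (-a)) ≤
      t ^ a * ((t - y) ^ (-(a + γ)) * (y - x) ^ γ) := by gcongr
  have hA' : 0 ≤ (y ^ a - x ^ a) * (t - x) ^ (-a) :=
    mul_nonneg (by linarith) (by positivity)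
  have hB' : 0 ≤ y ^ a * ((t - y) ^ (-a) - (t - x) ^ (-a)) :=
    mul_nonneg (by positivity) (by linarith)
  rw [abs_le]
  constructor <;> linarith

/-- Regularity of the second term of the kernel, with a weight singular at `0`. -/
lemma exists_abs_rpow_neg_mul_integral_sub_le {a t γ : ℝ} (ha₀ : 0 < a) (ha₁ : a < 1 / 2)
    (ht : 0 < t) (hγ₀ : 0 ≤ γ) (hγ : γ ≤ a) :
    ∃ C, 0 ≤ C ∧ ∀ x y, 0 < x → x < y → y < t →
      |x ^ (-a) * (∫ r in x..t, r ^ (2 * a - 1) * (t - r) ^ (-a)) -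
        y ^ (-a) * ∫ r in y..t, r ^ (2 * a - 1) * (t - r) ^ (-a)| ≤
      C * (x ^ (-(a + γ)) * (y - x) ^ γ) := by
  obtain ⟨C, hC, hI⟩ := exists_integral_rpow_mul_sub_rpow_le ha₀ ha₁ ht hγ₀ hγ
  refine ⟨2 * (C * t ^ γ), by positivity, fun x y hx hxy hy => ?_⟩
  have hd : 0 < y - x := by linarith
  have hadd := intervalIntegral.integral_add_adjacent_intervals
    (intervalIntegrable_rpow_mul_sub_rpow ha₀ ha₁ hx.le hxy.le hy.le)
    (intervalIntegrable_rpow_mul_sub_rpow ha₀ ha₁ (hx.trans hxy).le hy.le le_rfl)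
  rw [← hadd]
  have hU := hI x y hx.le hxy hy.le
  have hV := hI y t (hx.trans hxy).le hy le_rfl
  have hU0 := integral_rpow_mul_sub_rpow_nonneg (a := a) hx.le hxy.le hy.le
  have hV0 := integral_rpow_mul_sub_rpow_nonneg (a := a) (hx.trans hxy).le hy.le le_rfl
  set U := ∫ r in x..y, r ^ (2 * a - 1) * (t - r) ^ (-a)
  set V := ∫ r in y..t, r ^ (2 * a - 1) * (t - r) ^ (-a)
  have hV' : V ≤ C * t ^ γ := hV.trans (by gcongr; linarith)
  have h1 := rpow_neg_sub_rpow_neg_le hx hxy.le (a := a) (γ := γ) (by linarith) hγ₀ (by linarith)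
  have h2 : y ^ (-a) ≤ x ^ (-a) := Real.rpow_le_rpow_of_nonpos hx hxy.le (by linarith)
  have h3 : x ^ (-a) ≤ t ^ γ * x ^ (-(a + γ)) := by
    calc x ^ (-a) = x ^ γ * x ^ (-(a + γ)) := by rw [← Real.rpow_add hx]; congr 1; ring
      _ ≤ _ := by gcongr; linarith
  have hA : x ^ (-a) * U ≤ C * t ^ γ * (x ^ (-(a + γ)) * (y - x) ^ γ) := by
    calc x ^ (-a) * U ≤ (t ^ γ * x ^ (-(a + γ))) * (C * (y - x) ^ γ) := by gcongr
      _ = _ := by ring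
  have hB : (x ^ (-a) - y ^ (-a)) * V ≤ C * t ^ γ * (x ^ (-(a + γ)) * (y - x) ^ γ) := by
    calc (x ^ (-a) - y ^ (-a)) * V ≤ (x ^ (-(a + γ)) * (y - x) ^ γ) * (C * t ^ γ) := by gcongr
      _ = _ := by ring
  have hA' : 0 ≤ x ^ (-a) * U := by positivity
  have hB' : 0 ≤ (x ^ (-a) - y ^ (-a)) * V := mul_nonneg (by linarith) hV0
  rw [abs_le]
  constructor <;> linarith

lemma KH_eq {H t s : ℝ} (hs : 0 < s) (hst : s < t) :
    KH H t s = cH H * (t ^ (-(1 / 2 - H)) * (s ^ (1 / 2 - H) * (t - s) ^ (-(1 / 2 - H))) +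
      (1 / 2 - H) * t ^ (-(1 / 2 - H)) * (s ^ (-(1 / 2 - H)) *
        ∫ r in s..t, r ^ (2 * (1 / 2 - H) - 1) * (t - r) ^ (-(1 / 2 - H)))) := by
  have ht : 0 < t := hs.trans hst
  have h := setIntegral_Ioo_rpow_mul_sub_rpow (a := 1 / 2 - H) hs hst
  rw [KH, show H - 3 / 2 = -(1 / 2 - H) - 1 by ring, show H - 1 / 2 = -(1 / 2 - H) by ring, h,
    Real.div_rpow ht.le hs.le, Real.rpow_neg hs.le (1 / 2 - H),
    show -2 * (1 / 2 - H) = -(1 / 2 - H) + -(1 / 2 - H) by ring, Real.rpow_add hs,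
    Real.rpow_neg hs.le (1 / 2 - H)]
  have := (Real.rpow_pos_of_pos hs (1 / 2 - H)).ne'
  field_simp

lemma exists_abs_KH_sub_le {H t γ : ℝ} (hH : H ∈ Ioo (0 : ℝ) (1 / 2)) (ht : 0 < t)
    (hγ₀ : 0 ≤ γ) (hγ : γ ≤ 1 / 2 - H) :
    ∃ C, 0 ≤ C ∧ ∀ x y, 0 < x → x < y → y < t →
      |KH H t x - KH H t y| ≤
        C * ((x ^ (-(1 / 2 - H + γ)) + (t - y) ^ (-(1 / 2 - H + γ))) * (y - x) ^ γ) := by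
  have ha₀ : 0 < 1 / 2 - H := sub_pos.2 hH.2
  have ha₁ : 1 / 2 - H < 1 / 2 := by linarith [hH.1]
  obtain ⟨C, hC, hI⟩ := exists_abs_rpow_neg_mul_integral_sub_le ha₀ ha₁ ht hγ₀ hγ
  have hc : 0 ≤ cH H := Real.sqrt_nonneg _
  refine ⟨cH H * (2 + (1 / 2 - H) * t ^ (-(1 / 2 - H)) * C), by positivity,
    fun x y hx hxy hy => ?_⟩
  have hB := hI x y hx hxy hy
  have hA := abs_rpow_mul_sub_rpow_sub_le ha₀ ha₁ hγ₀ hγ hx hxy hy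
  rw [KH_eq hx (hxy.trans hy), KH_eq (hx.trans hxy) hy]
  set a := 1 / 2 - H
  have hd : 0 < y - x := by linarith
  have hty : 0 < t - y := by linarith
  have hta : t ^ (-a) * t ^ a = 1 := by rw [← Real.rpow_add ht]; simp
  set P := x ^ (-(a + γ)) * (y - x) ^ γ with hP
  set Q := (t - y) ^ (-(a + γ)) * (y - x) ^ γ with hQ
  have hP0 : 0 ≤ P := by positivity
  have hQ0 : 0 ≤ Q := by positivity
  rw [add_mul, ← hP, ← hQ, ← mul_sub, abs_mul, abs_of_nonneg hc, mul_assoc (cH H), add_sub_add_comm,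
    ← mul_sub, ← mul_sub]
  refine mul_le_mul_of_nonneg_left ((abs_add_le _ _).trans ?_) hc
  rw [abs_mul, abs_mul, abs_of_nonneg (by positivity : 0 ≤ t ^ (-a)),
    abs_of_nonneg (by positivity : 0 ≤ a * t ^ (-a))]
  calc _ ≤ t ^ (-a) * (2 * t ^ a * Q) + a * t ^ (-a) * (C * P) := by gcongr
    _ = 2 * (t ^ (-a) * t ^ a) * Q + a * t ^ (-a) * C * P := by ring
    _ = 2 * Q + a * t ^ (-a) * C * P := by rw [hta, mul_one]
    _ ≤ 2 * (P + Q) + a * t ^ (-a) * C * (P + Q) := by gcongr <;> linarith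
    _ = _ := by ring

/-- A kernel of the form `w x * k (x - y)` with `w` and `k` locally integrable has finite integral
over a square. -/
lemma setLIntegral_prod_mul_sub_lt_top {w k : ℝ → ℝ≥0∞} {t : ℝ} (hw : Measurable w)
    (hk : Measurable k) (hwi : ∫⁻ x in Ioo 0 t, w x < ⊤) (hki : ∫⁻ z in Ioo (-t) t, k z < ⊤) :
    ∫⁻ x in Ioo 0 t ×ˢ Ioo 0 t, w x.1 * k (x.1 - x.2) ∂(volume : Measure (ℝ × ℝ)) < ⊤ := by
  have hin : ∀ x ∈ Ioo (0 : ℝ) t, ∫⁻ y in Ioo 0 t, k (x - y) ≤ ∫⁻ z in Ioo (-t) t, k z := by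
    intro x hx
    rw [← lintegral_indicator measurableSet_Ioo, ← lintegral_indicator measurableSet_Ioo,
      ← lintegral_sub_left_eq_self ((Ioo (-t) t).indicator k) x]
    refine lintegral_mono fun y => ?_
    by_cases hy : y ∈ Ioo 0 t
    · have : x - y ∈ Ioo (-t) t := ⟨by linarith [hx.1, hy.2], by linarith [hx.2, hy.1]⟩
      simp [hy, this]
    · simp [hy]
  rw [Measure.volume_eq_prod, ← Measure.prod_restrict, lintegral_prod _ (by fun_prop)]
  calc _ ≤ ∫⁻ x in Ioo 0 t, w x * ∫⁻ z in Ioo (-t) t, k z := by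
        refine setLIntegral_mono' measurableSet_Ioo fun x hx => ?_
        simp only
        rw [lintegral_const_mul _ (by fun_prop)]
        exact mul_le_mul_right (hin x hx) _
    _ = (∫⁻ x in Ioo 0 t, w x) * ∫⁻ z in Ioo (-t) t, k z := lintegral_mul_const _ hw
    _ < ⊤ := ENNReal.mul_lt_top hwi hki

lemma setLIntegral_ofReal_abs_rpow_lt_top {p t : ℝ} (hp : -1 < p) (ht : 0 < t) :
    ∫⁻ z in Ioo (-t) t, ENNReal.ofReal (|z| ^ p) < ⊤ := by
  have h : IntervalIntegrable (fun z : ℝ => |z| ^ p) volume 0 t :=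
    (intervalIntegral.intervalIntegrable_rpow' hp).congr fun z hz => by
      rw [uIoc_of_le ht.le] at hz
      simp only [abs_of_pos hz.1]
  have h' : IntervalIntegrable (fun z : ℝ => |z| ^ p) volume (-t) 0 := by
    simpa using ((IntervalIntegrable.iff_comp_neg (by simp)).1 h).symm
  have hi : IntegrableOn (fun z : ℝ => |z| ^ p) (Ioo (-t) t) volume :=
    ((intervalIntegrable_iff_integrableOn_Ioc_of_le (by linarith)).1 (h'.trans h)).mono_set
      Ioo_subset_Ioc_self
  exact Integrable.lintegral_lt_top hi

lemma setLIntegral_ofReal_rpow_add_lt_top {p t : ℝ} (hp : -1 < p) (ht : 0 < t) :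
    ∫⁻ x in Ioo 0 t, ENNReal.ofReal (x ^ p + (t - x) ^ p) < ⊤ := by
  have h : IntervalIntegrable (fun x : ℝ => x ^ p + (t - x) ^ p) volume 0 t :=
    (intervalIntegral.intervalIntegrable_rpow' hp).add (intervalIntegrable_sub_rpow hp)
  have hi : IntegrableOn (fun x : ℝ => x ^ p + (t - x) ^ p) (Ioo 0 t) volume :=
    ((intervalIntegrable_iff_integrableOn_Ioc_of_le ht.le).1 h).mono_set Ioo_subset_Ioc_self
  exact Integrable.lintegral_lt_top hi

lemma exists_sq_KH_sub_div_le {H t γ : ℝ} (hH : H ∈ Ioo (0 : ℝ) (1 / 2)) (ht : 0 < t)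
    (hγ₀ : 0 ≤ γ) (hγ : γ ≤ 1 / 2 - H) :
    ∃ C, 0 ≤ C ∧ ∀ x ∈ Ioo 0 t, ∀ y ∈ Ioo 0 t,
      (KH H t y - KH H t x) ^ 2 / |x - y| ^ (1 + γ) ≤
        C * ((x ^ (-2 * (1 / 2 - H + γ)) + (t - x) ^ (-2 * (1 / 2 - H + γ))) * |x - y| ^ (γ - 1) +
          (y ^ (-2 * (1 / 2 - H + γ)) + (t - y) ^ (-2 * (1 / 2 - H + γ))) * |x - y| ^ (γ - 1)) := by
  obtain ⟨C, hC, hK⟩ := exists_abs_KH_sub_le hH ht hγ₀ hγ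
  refine ⟨2 * C ^ 2, by positivity, ?_⟩
  set b := 1 / 2 - H + γ
  have hsq : ∀ z : ℝ, 0 < z → (z ^ (-b)) ^ 2 = z ^ (-2 * b) := fun z hz => by
    rw [← Real.rpow_natCast, ← Real.rpow_mul hz.le]; congr 1; push_cast; ring
  have key : ∀ x y, 0 < x → x < y → y < t →
      (KH H t x - KH H t y) ^ 2 / (y - x) ^ (1 + γ) ≤
        2 * C ^ 2 * ((x ^ (-2 * b) + (t - y) ^ (-2 * b)) * (y - x) ^ (γ - 1)) := by
    intro x y hx hxy hy
    have hd : 0 < y - x := sub_pos.2 hxy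
    have hty : 0 < t - y := sub_pos.2 hy
    have h1 := pow_le_pow_left₀ (abs_nonneg _) (hK x y hx hxy hy) 2
    rw [sq_abs] at h1
    have h2 : ((y - x) ^ γ) ^ 2 = (y - x) ^ (γ - 1) * (y - x) ^ (1 + γ) := by
      rw [← Real.rpow_add hd, sq, ← Real.rpow_add hd]; congr 1; ring
    rw [div_le_iff₀ (by positivity)]
    calc _ ≤ _ := h1
      _ = C ^ 2 * (x ^ (-b) + (t - y) ^ (-b)) ^ 2 * ((y - x) ^ γ) ^ 2 := by ring
      _ ≤ C ^ 2 * (2 * ((x ^ (-b)) ^ 2 + ((t - y) ^ (-b)) ^ 2)) * ((y - x) ^ γ) ^ 2 := by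
        gcongr
        exact add_sq_le
      _ = _ := by rw [hsq x hx, hsq _ hty, h2]; ring
  rintro x ⟨hx, hxt⟩ y ⟨hy, hyt⟩
  have htx : 0 < t - x := sub_pos.2 hxt
  have hty : 0 < t - y := sub_pos.2 hyt
  rcases lt_trichotomy x y with h | rfl | h
  · have hd : 0 < y - x := sub_pos.2 h
    rw [abs_sub_comm x y, abs_of_pos hd, sub_sq_comm, ← add_mul]
    refine (key x y hx h hyt).trans ?_
    gcongr 2 * C ^ 2 * (?_ * _)
    linarith [Real.rpow_pos_of_pos htx (-2 * b), Real.rpow_pos_of_pos hy (-2 * b)]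
  · simp only [sub_self, ne_eq, OfNat.ofNat_ne_zero, not_false_eq_true, zero_pow, zero_div]
    positivity
  · have hd : 0 < x - y := sub_pos.2 h
    rw [abs_of_pos hd, ← add_mul]
    refine (key y x hy h hxt).trans ?_
    gcongr 2 * C ^ 2 * (?_ * _)
    linarith [Real.rpow_pos_of_pos hty (-2 * b), Real.rpow_pos_of_pos hx (-2 * b)]

/-- For `H ∈ (0,1/2)`, `T > 0` and `t ∈ (0,T]` there is `β ∈ (0,1/2)`
such that `∫_0^t ∫_0^t (K_H(t,t₀') - K_H(t,t₀))² / |t₀ - t₀'|^{1+2β} dt₀ dt₀' < ∞`. -/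
theorem statement17 (H T t : ℝ) (hH : H ∈ Set.Ioo (0 : ℝ) (1 / 2)) (hT : 0 < T)
    (ht : t ∈ Set.Ioc (0 : ℝ) T) :
    ∃ β ∈ Set.Ioo (0 : ℝ) (1 / 2),
      (∫⁻ x in (Set.Ioo (0 : ℝ) t) ×ˢ (Set.Ioo (0 : ℝ) t),
        ENNReal.ofReal ((KH H t x.2 - KH H t x.1) ^ 2 / |x.1 - x.2| ^ (1 + 2 * β))
        ∂(volume : Measure (ℝ × ℝ))) < ⊤ := by
  have ht0 : 0 < t := ht.1
  have hH0 : 0 < H := hH.1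
  have ha₀ : 0 < 1 / 2 - H := sub_pos.2 hH.2
  set γ := (1 / 2 - H) * H with hγdef
  have hγ₀ : 0 < γ := by positivity
  have hγa : γ ≤ 1 / 2 - H := by nlinarith [hH.2]
  have hγH : γ < H := by nlinarith
  obtain ⟨C, hC, hbound⟩ := exists_sq_KH_sub_div_le hH ht0 hγ₀.le hγa
  refine ⟨γ / 2, ⟨by positivity, by linarith [hH.2]⟩, ?_⟩
  rw [show 1 + 2 * (γ / 2) = 1 + γ by ring]
  set p := -2 * (1 / 2 - H + γ) with hp
  have hp1 : -1 < p := by linarith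
  set w : ℝ → ℝ≥0∞ := fun x => ENNReal.ofReal (x ^ p + (t - x) ^ p) with hw
  set k : ℝ → ℝ≥0∞ := fun z => ENNReal.ofReal (|z| ^ (γ - 1)) with hk
  have hwm : Measurable w := by fun_prop
  have hkm : Measurable k := by fun_prop
  have hfin := setLIntegral_prod_mul_sub_lt_top hwm hkm
    (setLIntegral_ofReal_rpow_add_lt_top hp1 ht0)
    (setLIntegral_ofReal_abs_rpow_lt_top (by linarith) ht0)
  have hfin' : ∫⁻ x in Ioo 0 t ×ˢ Ioo 0 t, w x.2 * k (x.1 - x.2)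
      ∂(volume : Measure (ℝ × ℝ)) < ⊤ := by
    rw [Measure.volume_eq_prod, ← Measure.prod_restrict] at hfin ⊢
    rw [← lintegral_prod_swap] at hfin
    simpa only [Prod.fst_swap, Prod.snd_swap, hk, abs_sub_comm] using hfin
  calc _ ≤ ∫⁻ x in Ioo 0 t ×ˢ Ioo 0 t, ENNReal.ofReal C *
          (w x.1 * k (x.1 - x.2) + w x.2 * k (x.1 - x.2)) ∂(volume : Measure (ℝ × ℝ)) := by
        refine setLIntegral_mono' (measurableSet_Ioo.prod measurableSet_Ioo) fun x hx => ?_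
        have hx1 : 0 < t - x.1 := sub_pos.2 hx.1.2
        have hx2 : 0 < t - x.2 := sub_pos.2 hx.2.2
        have hx1' : 0 < x.1 := hx.1.1
        have hx2' : 0 < x.2 := hx.2.1
        simp only [hw, hk]
        rw [← ENNReal.ofReal_mul (by positivity), ← ENNReal.ofReal_mul (by positivity),
          ← ENNReal.ofReal_add (by positivity) (by positivity), ← ENNReal.ofReal_mul hC]
        exact ENNReal.ofReal_le_ofReal (hbound x.1 hx.1 x.2 hx.2)
    _ < ⊤ := by
        rw [lintegral_const_mul _ (by fun_prop), lintegral_add_left (by fun_prop)]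
        exact ENNReal.mul_lt_top ENNReal.ofReal_lt_top (ENNReal.add_lt_top.2 ⟨hfin, hfin'⟩)
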